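/- Let g : ℝ^n → ℝ^m be twice continuously differentiable with ‖∇²g(z)‖ ≤ 𝒦₁ for all z ∈ ℝ^n, let x ∈ ℝ^n, let Ω > 0, and let v ∈ ℝ^n be such that ∇g(x)ᵀv ∈ −int K. Define the model m(s) := ∇g(x)ᵀs + ½ sᵀ∇²g(x)s. Then there exists t̄ > 0 with ‖t̄ v‖ ≤ Ω such that Δ_{−K}(m(t̄ v)) ≤ Δ_{−K}(m(t v)) for all t ≥ 0 with ‖t v‖ ≤ Ω, and moreover Δ_{−K}(m(0) − m(t̄ v)) ≥ −½ · (Δ_{−K}(∇g(x)ᵀv)/‖v‖) · min{ −Δ_{−K}(∇g(x)ᵀv)/(‖v‖ 𝒦₁), Ω }. -/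

import Mathlib

open Set Metric

noncomputable section

/-- Oriented distance function `Δ_A(y) = d(y, A) − d(y, Aᶜ)`. -/
def orientedDist {E : Type*} [NormedAddCommGroup E] (A : Set E) (y : E) : ℝ :=
  Metric.infDist y A - Metric.infDist y Aᶜ

/-- The vector `sᵀ∇²f(x)s` of second-order directional derivatives. -/
def quadForm {E F : Type*} [NormedAddCommGroup E] [NormedSpace ℝ E]
    [NormedAddCommGroup F] [NormedSpace ℝ F] (f : E → F) (x s : E) : F :=
  fderiv ℝ (fun y => fderiv ℝ f y s) x s

/-- Quadratic model `m(s) = ∇g(x)ᵀs + ½ sᵀ∇²g(x)s`. -/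
def modelFn {E F : Type*} [NormedAddCommGroup E] [NormedSpace ℝ E]
    [NormedAddCommGroup F] [NormedSpace ℝ F] (f : E → F) (x s : E) : F :=
  fderiv ℝ f x s + (2⁻¹ : ℝ) • quadForm f x s

section OrientedDist

open scoped Pointwise

variable {E : Type*} [NormedAddCommGroup E] {A : Set E}

theorem orientedDist_le_norm (h0 : (0 : E) ∈ A) (y : E) : orientedDist A y ≤ ‖y‖ := by
  have h1 : infDist y A ≤ dist y 0 := infDist_le_dist_of_mem h0
  rw [dist_zero_right] at h1
  have h2 : 0 ≤ infDist y Aᶜ := infDist_nonneg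
  unfold orientedDist
  linarith

theorem continuous_orientedDist : Continuous (orientedDist A) :=
  (continuous_infDist_pt A).sub (continuous_infDist_pt Aᶜ)

theorem orientedDist_neg_of_mem_interior (hAc : Aᶜ.Nonempty) {y : E} (hy : y ∈ interior A) :
    orientedDist A y < 0 := by
  have h1 : infDist y A = 0 := infDist_zero_of_mem (interior_subset hy)
  have h2 : 0 < infDist y Aᶜ := by
    rw [← infDist_pos_iff_notMem_closure hAc, closure_compl, notMem_compl_iff]
    exact hy
  unfold orientedDist
  linarith

theorem orientedDist_add_le_of_mem (hne : A.Nonempty) (hAc : Aᶜ.Nonempty)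
    (hadd : ∀ a ∈ A, ∀ b ∈ A, a + b ∈ A) (y : E) {a : E} (ha : a ∈ A) :
    orientedDist A (y + a) ≤ orientedDist A y := by
  have h1 : infDist (y + a) A ≤ infDist y A := by
    rw [le_infDist hne]
    intro b hb
    simpa using infDist_le_dist_of_mem (x := y + a) (hadd b hb a ha)
  have h2 : infDist y Aᶜ ≤ infDist (y + a) Aᶜ := by
    rw [le_infDist hAc]
    intro w hw
    have hwa : w - a ∈ Aᶜ := fun h => hw (by simpa using hadd _ h a ha)
    have h := infDist_le_dist_of_mem (x := y) hwa
    rwa [dist_eq_norm, sub_sub_eq_add_sub, ← dist_eq_norm] at h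
  unfold orientedDist
  linarith

variable [NormedSpace ℝ E]

theorem orientedDist_smul (hcone : ∀ t : ℝ, 0 < t → ∀ y ∈ A, t • y ∈ A) {t : ℝ} (ht : 0 < t)
    (y : E) : orientedDist A (t • y) = t * orientedDist A y := by
  have hA : t • A = A := by
    ext z
    rw [mem_smul_set_iff_inv_smul_mem₀ ht.ne']
    refine ⟨fun h => ?_, fun h => hcone _ (inv_pos.2 ht) _ h⟩
    simpa [smul_smul, ht.ne'] using hcone t ht _ h
  have hAc : t • Aᶜ = Aᶜ := by
    rw [compl_eq_univ_sdiff, smul_set_sdiff₀ ht.ne', smul_set_univ₀ ht.ne', hA]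
  have h1 := infDist_smul₀ ht.ne' A y
  have h2 := infDist_smul₀ ht.ne' Aᶜ y
  rw [hA, Real.norm_of_nonneg ht.le] at h1
  rw [hAc, Real.norm_of_nonneg ht.le] at h2
  rw [orientedDist, orientedDist, h1, h2, mul_sub]

theorem orientedDist_zero (hcone : ∀ t : ℝ, 0 < t → ∀ y ∈ A, t • y ∈ A) :
    orientedDist A (0 : E) = 0 := by
  have h := orientedDist_smul hcone two_pos (0 : E)
  rw [smul_zero] at h
  linarith

theorem infDist_add_infDist_compl_le_dist (hA : IsClosed A) {p q : E} (hp : p ∈ A)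
    (hq : q ∉ A) : infDist q A + infDist p Aᶜ ≤ dist p q := by
  have hpq : 0 < dist p q := dist_pos.2 fun h => hq (h ▸ hp)
  set r := infDist p Aᶜ
  have hr0 : 0 ≤ r := infDist_nonneg
  have hr : r ≤ dist p q := infDist_le_dist_of_mem hq
  have hb : AffineMap.lineMap p q (r / dist p q) ∈ A := by
    refine hA.closure_subset (closedBall_infDist_compl_subset_closure hp ?_)
    rw [mem_closedBall, dist_lineMap_left, Real.norm_of_nonneg (by positivity),
      div_mul_cancel₀ _ hpq.ne']
  have h := infDist_le_dist_of_mem (x := q) hb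
  rw [dist_comm, dist_lineMap_right, Real.norm_of_nonneg, sub_mul,
    div_mul_cancel₀ _ hpq.ne', one_mul] at h
  · linarith
  · rw [sub_nonneg]
    exact div_le_one_of_le₀ hr hpq.le

theorem orientedDist_le_add_dist (hA : IsClosed A) (p q : E) :
    orientedDist A p ≤ orientedDist A q + dist p q := by
  unfold orientedDist
  have h1 : infDist p A ≤ infDist q A + dist p q := infDist_le_infDist_add_dist
  have h2 : infDist q Aᶜ ≤ infDist p Aᶜ + dist q p := infDist_le_infDist_add_dist
  rw [dist_comm q p] at h2
  have h3 : 0 ≤ infDist p Aᶜ := infDist_nonneg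
  by_cases hq : q ∈ A
  · have hq0 : infDist q A = 0 := infDist_zero_of_mem hq
    by_cases hp : p ∈ A
    · have hp0 : infDist p A = 0 := infDist_zero_of_mem hp
      linarith
    · have h := infDist_add_infDist_compl_le_dist hA hq hp
      rw [dist_comm q p] at h
      linarith
  · have hq0 : infDist q Aᶜ = 0 := infDist_zero_of_mem hq
    linarith

theorem infDist_compl_add_le (hA : IsClosed A) (hne : A.Nonempty) (hAc : Aᶜ.Nonempty)
    (hadd : ∀ a ∈ A, ∀ b ∈ A, a + b ∈ A) {y z : E} (hy : y ∈ A) (hz : z ∈ A) :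
    infDist y Aᶜ + infDist z Aᶜ ≤ infDist (y + z) Aᶜ := by
  rw [le_infDist hAc]
  intro w hw
  have hwy : w - y ∉ A := fun h => hw (by simpa using hadd _ h y hy)
  have h1 := infDist_add_infDist_compl_le_dist hA hz hwy
  have h2 : infDist y Aᶜ ≤ infDist (w - y) A := by
    rw [le_infDist hne]
    intro a ha
    have hwa : w - a ∈ Aᶜ := fun h => hw (by simpa using hadd _ h a ha)
    have h := infDist_le_dist_of_mem (x := y) hwa
    rwa [dist_comm, dist_eq_norm, sub_right_comm, ← dist_eq_norm] at h
  have h3 : dist z (w - y) = dist (y + z) w := by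
    rw [dist_eq_norm, dist_eq_norm]
    congr 1
    abel
  linarith

theorem orientedDist_add_le (hA : IsClosed A) (hne : A.Nonempty) (hAc : Aᶜ.Nonempty)
    (hadd : ∀ a ∈ A, ∀ b ∈ A, a + b ∈ A) (y z : E) :
    orientedDist A (y + z) ≤ orientedDist A y + orientedDist A z := by
  have key : ∀ y z : E, z ∉ A →
      orientedDist A (y + z) ≤ orientedDist A y + orientedDist A z := by
    intro y z hz
    have hz0 : infDist z Aᶜ = 0 := infDist_zero_of_mem hz
    have h : orientedDist A (y + z) - orientedDist A y ≤ infDist z A := by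
      rw [le_infDist hne]
      intro a ha
      have h1 := orientedDist_le_add_dist hA (y + z) (y + a)
      have h2 := orientedDist_add_le_of_mem hne hAc hadd y ha
      rw [dist_add_left] at h1
      linarith
    have h3 : orientedDist A z = infDist z A := by rw [orientedDist, hz0, sub_zero]
    linarith
  by_cases hz : z ∈ A
  · by_cases hy : y ∈ A
    · have h := infDist_compl_add_le hA hne hAc hadd hy hz
      unfold orientedDist
      rw [infDist_zero_of_mem hy, infDist_zero_of_mem hz,
        infDist_zero_of_mem (hadd y hy z hz)]
      linarith
    · rw [add_comm y z, add_comm (orientedDist A y)]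
      exact key z y hy
  · exact key y z hz

end OrientedDist

section Model

variable {E F : Type*} [NormedAddCommGroup E] [NormedSpace ℝ E]
  [NormedAddCommGroup F] [NormedSpace ℝ F] {f : E → F}

theorem quadForm_eq_fderiv_fderiv (hf : ContDiff ℝ 2 f) (x s : E) :
    quadForm f x s = fderiv ℝ (fderiv ℝ f) x s s := by
  have hd : DifferentiableAt ℝ (fderiv ℝ f) x :=
    ((hf.fderiv_right (m := 1) (by norm_num)).differentiable (by norm_num)).differentiableAt
  rw [quadForm, fderiv_clm_apply hd (differentiableAt_const s)]
  simp

theorem norm_quadForm_le (hf : ContDiff ℝ 2 f) (x s : E) :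
    ‖quadForm f x s‖ ≤ ‖iteratedFDeriv ℝ 2 f x‖ * ‖s‖ ^ 2 := by
  have h := (iteratedFDeriv ℝ 2 f x).le_opNorm ![s, s]
  rw [iteratedFDeriv_two_apply] at h
  simpa [quadForm_eq_fderiv_fderiv hf, Fin.prod_univ_two, sq] using h

theorem modelFn_smul (hf : ContDiff ℝ 2 f) (x s : E) (t : ℝ) :
    modelFn f x (t • s) = t • fderiv ℝ f x s + (t ^ 2 / 2) • quadForm f x s := by
  rw [modelFn, quadForm_eq_fderiv_fderiv hf, quadForm_eq_fderiv_fderiv hf]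
  simp only [map_smul, _root_.smul_apply, smul_smul]
  congr 2
  ring

end Model

/-- along a descent direction `v` (i.e. `∇g(x)ᵀv ∈ −int K`), there is a
step length `t̄` minimizing `Δ_{−K}(m(t v))` on the trust region, and the corresponding
model reduction satisfies the Cauchy-type sufficient decrease bound
(Theorem `fsgcsb`). -/
theorem model_decrease_along_descent_direction
    {n m : ℕ} (K : Set (EuclideanSpace ℝ (Fin m)))
    (hKne : K.Nonempty) (hKclosed : IsClosed K) (hKconvex : Convex ℝ K)
    (hKcone : ∀ t : ℝ, 0 ≤ t → ∀ y ∈ K, t • y ∈ K)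
    (hKpointed : K ∩ -K = {0})
    (hKsolid : (interior K).Nonempty)
    (g : EuclideanSpace ℝ (Fin n) → EuclideanSpace ℝ (Fin m))
    (hg : ContDiff ℝ 2 g)
    (K₁ : ℝ) (hK₁ : ∀ z : EuclideanSpace ℝ (Fin n), ‖iteratedFDeriv ℝ 2 g z‖ ≤ K₁)
    (x : EuclideanSpace ℝ (Fin n))
    (Ω : ℝ) (hΩ : 0 < Ω)
    (v : EuclideanSpace ℝ (Fin n))
    (hv : fderiv ℝ g x v ∈ -interior K) :
    ∃ tb > (0 : ℝ), ‖tb • v‖ ≤ Ω ∧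
      (∀ t : ℝ, 0 ≤ t → ‖t • v‖ ≤ Ω →
        orientedDist (-K) (modelFn g x (tb • v)) ≤ orientedDist (-K) (modelFn g x (t • v))) ∧
      orientedDist (-K) (modelFn g x 0 - modelFn g x (tb • v)) ≥
        -(2⁻¹ : ℝ) * (orientedDist (-K) (fderiv ℝ g x v) / ‖v‖) *
          min (-(orientedDist (-K) (fderiv ℝ g x v)) / (‖v‖ * K₁)) Ω := by
  set A : Set (EuclideanSpace ℝ (Fin m)) := -K with hA_def
  have hA : IsClosed A := hKclosed.neg
  have hne : A.Nonempty := hKne.neg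
  have hcone : ∀ t : ℝ, 0 ≤ t → ∀ y ∈ A, t • y ∈ A := by
    intro t ht y hy
    rw [hA_def, Set.mem_neg, ← smul_neg]
    exact hKcone t ht _ hy
  have hcone' : ∀ t : ℝ, 0 < t → ∀ y ∈ A, t • y ∈ A := fun t ht => hcone t ht.le
  rcases Aᶜ.eq_empty_or_nonempty with hAc | hAc
  · have hz : ∀ y, orientedDist A y = 0 := by
      intro y
      rw [orientedDist, hAc, infDist_empty,
        infDist_zero_of_mem (compl_empty_iff.1 hAc ▸ mem_univ y), sub_zero]
    refine ⟨Ω / (‖v‖ + 1), by positivity, ?_, fun t _ _ => by rw [hz, hz], ?_⟩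
    · rw [norm_smul, Real.norm_of_nonneg (by positivity), div_mul_eq_mul_div,
        div_le_iff₀ (by positivity)]
      nlinarith [norm_nonneg v]
    · simp [hz]
  have hadd : ∀ a ∈ A, ∀ b ∈ A, a + b ∈ A := by
    intro a ha b hb
    have h := hcone 2 zero_le_two _
      (hKconvex.neg ha hb (by norm_num : (0 : ℝ) ≤ 2⁻¹) (by norm_num : (0 : ℝ) ≤ 2⁻¹)
        (by norm_num))
    rwa [smul_add, smul_smul, smul_smul, mul_inv_cancel₀ two_ne_zero, one_smul, one_smul] at h
  have h0A : (0 : EuclideanSpace ℝ (Fin m)) ∈ A := by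
    obtain ⟨a, ha⟩ := hne
    simpa using hcone 0 le_rfl a ha
  have hΔ0 := orientedDist_zero hcone'
  have hsub := orientedDist_add_le hA hne hAc hadd
  set D := orientedDist A (fderiv ℝ g x v)
  have hD : D < 0 := by
    refine orientedDist_neg_of_mem_interior hAc ?_
    have hint : -interior K ⊆ interior A :=
      interior_maximal (Set.neg_subset_neg.2 interior_subset) isOpen_interior.neg
    exact hint hv
  have hvpos : 0 < ‖v‖ := by
    rw [norm_pos_iff]
    intro h
    have : D = 0 := by simp only [D, h, map_zero, hΔ0]
    linarith
  have hK₁0 : 0 ≤ K₁ := (norm_nonneg _).trans (hK₁ x)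
  have hm0 : modelFn g x 0 = 0 := by simpa using modelFn_smul hg x v 0
  have hbound : ∀ t : ℝ, 0 ≤ t →
      orientedDist A (modelFn g x (t • v)) ≤ t * D + t ^ 2 / 2 * (K₁ * ‖v‖ ^ 2) := by
    intro t ht
    rcases ht.eq_or_lt with rfl | ht
    · simp [hm0, hΔ0]
    have h1 := hsub (t • fderiv ℝ g x v) ((t ^ 2 / 2) • quadForm g x v)
    rw [← modelFn_smul hg, orientedDist_smul hcone' ht,
      orientedDist_smul hcone' (by positivity : 0 < t ^ 2 / 2)] at h1
    have h2 : orientedDist A (quadForm g x v) ≤ K₁ * ‖v‖ ^ 2 :=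
      (orientedDist_le_norm h0A _).trans <| (norm_quadForm_le hg x v).trans <|
        mul_le_mul_of_nonneg_right (hK₁ x) (by positivity)
    have h3 := mul_le_mul_of_nonneg_left h2 (by positivity : 0 ≤ t ^ 2 / 2)
    linarith
  have hfeas : ∀ t : ℝ, 0 ≤ t → (‖t • v‖ ≤ Ω ↔ t ≤ Ω / ‖v‖) := by
    intro t ht
    rw [norm_smul, Real.norm_of_nonneg ht, le_div_iff₀ hvpos]
  have hcont : Continuous fun t : ℝ => orientedDist A (modelFn g x (t • v)) := by
    refine continuous_orientedDist.comp ?_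
    simp only [modelFn_smul hg]
    fun_prop
  obtain ⟨tb, ⟨htb0, htbΩ⟩, hmin⟩ := isCompact_Icc.exists_isMinOn
    (nonempty_Icc.2 (by positivity : 0 ≤ Ω / ‖v‖)) hcont.continuousOn
  have hmin' : ∀ t : ℝ, 0 ≤ t → t ≤ Ω / ‖v‖ →
      orientedDist A (modelFn g x (tb • v)) ≤ orientedDist A (modelFn g x (t • v)) :=
    fun t h1 h2 => hmin ⟨h1, h2⟩
  have hneg : orientedDist A (modelFn g x (tb • v)) < 0 := by
    set c := K₁ * ‖v‖ ^ 2
    have hc : 0 ≤ c := by positivity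
    have hc1 : 0 < c + 1 := by positivity
    set t := min (Ω / ‖v‖) (-D / (c + 1))
    have ht : 0 < t := lt_min (by positivity) (div_pos (neg_pos.2 hD) hc1)
    have htc : t * (c + 1) ≤ -D := (le_div_iff₀ hc1).1 (min_le_right _ _)
    refine ((hmin' t ht.le (min_le_left _ _)).trans (hbound t ht.le)).trans_lt ?_
    have h : t * D + t ^ 2 / 2 * c = t * (D + t * c / 2) := by ring
    rw [h]
    refine mul_neg_of_pos_of_neg ht ?_
    nlinarith
  have htb : 0 < tb := by
    refine htb0.lt_of_ne' ?_
    rintro rfl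
    simp [hm0, hΔ0] at hneg
  refine ⟨tb, htb, (hfeas tb htb0).2 htbΩ, fun t ht htΩ => hmin' t ht ((hfeas t ht).1 htΩ), ?_⟩
  have hopp := hsub (modelFn g x (tb • v)) (-modelFn g x (tb • v))
  rw [add_neg_cancel, hΔ0] at hopp
  rw [hm0, zero_sub]
  set M := min (-D / (‖v‖ * K₁)) Ω
  have hM0 : 0 ≤ M := le_min (div_nonneg (neg_nonneg.2 hD.le) (by positivity)) hΩ.le
  have hMK : M * K₁ ≤ -D / ‖v‖ := by
    rcases hK₁0.eq_or_lt with h | h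
    · rw [← h, mul_zero]
      exact div_nonneg (neg_nonneg.2 hD.le) hvpos.le
    · have h1 : M ≤ -D / (‖v‖ * K₁) := min_le_left _ _
      rwa [← div_div, le_div_iff₀ h] at h1
  have hstep := (hmin' (M / ‖v‖) (by positivity)
    (div_le_div_of_nonneg_right (min_le_right _ _) hvpos.le)).trans
      (hbound (M / ‖v‖) (by positivity))
  have hval : M / ‖v‖ * D + (M / ‖v‖) ^ 2 / 2 * (K₁ * ‖v‖ ^ 2) =
      M * (D / ‖v‖) + M * (M * K₁) / 2 := by
    field_simp
  rw [hval] at hstep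
  have hprod := mul_le_mul_of_nonneg_left hMK hM0
  rw [neg_div, mul_neg] at hprod
  linarith
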